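/- Let (a_t)_{t∈ℕ₀} be a bounded real sequence whose space 𝒱 of delayed vectors has finite dimension D. Then there exist a density matrix ρ, a trace-preserving completely positive linear map T, and a Hermitian matrix A, all on ℂ^(D+2), such that a_t = tr(A · T^t(ρ)) for all t ∈ ℕ₀. -/

import Mathlib

open Matrix
open scoped ComplexOrder

open Filter Topology in
/-- A relatively compact orbit of powers accumulates at an idempotent. -/
theorem exists_idempotent_mem_closure_powers {R : Type*} [NormedRing R] [ProperSpace R] (s : R)
    {C : ℝ} (hC : ∀ k, ‖s ^ k‖ ≤ C) :
    ∃ p : R, p * p = p ∧ ∀ m, p ∈ closure {x | ∃ k, m ≤ k ∧ x = s ^ k} := by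
  have hcpt : IsCompact (closure {x | ∃ k, 1 ≤ k ∧ x = s ^ k}) := by
    refine (Metric.isBounded_closure_of_isBounded ?_).isCompact_closure.of_isClosed_subset
      isClosed_closure subset_closure
    refine isBounded_iff_forall_norm_le.2 ⟨C, ?_⟩
    rintro _ ⟨k, -, rfl⟩
    exact hC k
  obtain ⟨p, hp, hpp⟩ := exists_idempotent_in_compact_subsemigroup
    (fun r : R => continuous_mul_const r) (closure {x | ∃ k, 1 ≤ k ∧ x = s ^ k})
    ⟨s ^ 1, subset_closure ⟨1, le_rfl, rfl⟩⟩ hcpt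
    (by
      intro x hx y hy
      refine map_mem_closure₂ continuous_mul hx hy ?_
      rintro _ ⟨k, hk, rfl⟩ _ ⟨l, -, rfl⟩
      exact ⟨k + l, by omega, (pow_add s k l).symm⟩)
  refine ⟨p, hpp, fun m => ?_⟩
  have hpow : p ^ (m + 1) = p := by
    induction m with
    | zero => simp
    | succ m ih => rw [pow_succ, ih, hpp]
  have := map_mem_closure (continuous_pow (m + 1)) hp
    (t := {x | ∃ k, m ≤ k ∧ x = s ^ k}) (by
      rintro _ ⟨k, hk, rfl⟩
      exact ⟨k * (m + 1), by nlinarith, (pow_mul s k (m + 1)).symm⟩)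
  rwa [hpow] at this

section CStar

variable {A : Type*} [CStarAlgebra A] [PartialOrder A] [StarOrderedRing A]

theorem star_mul_self_mul_le {C : ℝ} {x : A} (hx : ‖x‖ ≤ C) (y : A) :
    star (x * y) * (x * y) ≤ C ^ 2 • (star y * y) := by
  have h := CStarAlgebra.star_left_conjugate_le_norm_smul (a := y) (b := star x * x)
    (.star_mul_self x)
  have h2 : ‖star x * x‖ ≤ C ^ 2 := by
    rw [CStarRing.norm_star_mul_self, pow_two]
    gcongr
    exact (norm_nonneg x).trans hx
  calc star (x * y) * (x * y) = star y * (star x * x) * y := by simp only [star_mul, mul_assoc]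
    _ ≤ ‖star x * x‖ • (star y * y) := h
    _ ≤ _ := smul_le_smul_of_nonneg_right h2 (star_mul_self_nonneg y)

open Filter Topology in
/-- The orbit averages of `star (s ^ k) * s ^ k` accumulate at a form preserved by `s`. -/
theorem exists_invariant_cesaro_limit [ProperSpace A] (s : A) {C : ℝ} (hC : ∀ k, ‖s ^ k‖ ≤ C)
    {b : A} (hb : ∀ k, b ≤ star (s ^ k) * s ^ k) :
    ∃ q : A, b ≤ q ∧ star s * q * s = q := by
  set f : ℕ → A := fun k => star (s ^ k) * s ^ k with hf
  set B : ℕ → A := fun N => ((N : ℝ) + 1)⁻¹ • ∑ k ∈ Finset.range (N + 1), f k with hB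
  have hfC : ∀ k, ‖f k‖ ≤ C * C := fun k => by
    have h0 : 0 ≤ C := (norm_nonneg _).trans (hC k)
    simp only [hf, CStarRing.norm_star_mul_self]
    exact mul_le_mul (hC k) (hC k) (norm_nonneg _) h0
  have hBC : ∀ N, B N ∈ Metric.closedBall (0 : A) (C * C) := fun N => by
    have hN : (0 : ℝ) < (N : ℝ) + 1 := by positivity
    rw [mem_closedBall_zero_iff, hB, norm_smul, Real.norm_of_nonneg (inv_nonneg.2 hN.le),
      inv_mul_le_iff₀ hN]
    refine (norm_sum_le_of_le _ fun k _ => hfC k).trans ?_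
    simp
  obtain ⟨q, -, φ, hφ, hq⟩ := tendsto_subseq_of_bounded Metric.isBounded_closedBall hBC
  refine ⟨q, ge_of_tendsto' hq fun n => ?_, ?_⟩
  · have hN : (0 : ℝ) < (φ n : ℝ) + 1 := by positivity
    have h1 : ((φ n : ℝ) + 1) • b ≤ ∑ k ∈ Finset.range (φ n + 1), f k := by
      have := Finset.card_nsmul_le_sum (Finset.range (φ n + 1)) f b fun k _ => hb k
      rw [Finset.card_range, ← Nat.cast_smul_eq_nsmul ℝ] at this
      exact_mod_cast this
    have := smul_le_smul_of_nonneg_left h1 (inv_nonneg.2 hN.le)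
    rwa [inv_smul_smul₀ hN.ne'] at this
  · have hstep : ∀ N, star s * B N * s - B N = ((N : ℝ) + 1)⁻¹ • (f (N + 1) - f 0) := fun N => by
      have hs : ∀ k, star s * f k * s = f (k + 1) := fun k => by
        simp only [hf, pow_succ, star_mul, mul_assoc]
      simp only [hB, mul_smul_comm, smul_mul_assoc, Finset.mul_sum, Finset.sum_mul, hs,
        ← smul_sub, ← Finset.sum_sub_distrib, Finset.sum_range_sub]
    have h1 : Tendsto (fun N => star s * B N * s - B N) atTop (𝓝 0) := by
      simp only [hstep]
      refine squeeze_zero_norm (a := fun N : ℕ => (1 / ((N : ℝ) + 1)) * (C * C + C * C))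
        (fun N => ?_)
        (by simpa using tendsto_one_div_add_atTop_nhds_zero_nat.mul_const (C * C + C * C))
      rw [norm_smul, Real.norm_of_nonneg (by positivity), one_div]
      gcongr
      exact (norm_sub_le _ _).trans (add_le_add (hfC _) (hfC _))
    have h2 : Tendsto (fun n => star s * B (φ n) * s - B (φ n)) atTop (𝓝 (star s * q * s - q)) :=
      ((hq.const_mul (star s)).mul_const s).sub hq
    exact sub_eq_zero.1 (tendsto_nhds_unique h2 (h1.comp hφ.tendsto_atTop))

/-- A power bounded element is contractive for some strictly positive form. -/
theorem exists_isStrictlyPositive_conjugate_le [ProperSpace A] (s : A) {C : ℝ}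
    (hC : ∀ k, ‖s ^ k‖ ≤ C) :
    ∃ q : A, IsStrictlyPositive q ∧ star s * q * s ≤ q := by
  wlog hC0 : 0 < C generalizing C
  · exact this (C := max C 1) (fun k => (hC k).trans (le_max_left _ _)) (by positivity)
  obtain ⟨p, hpp, hp⟩ := exists_idempotent_mem_closure_powers s hC
  have hcomm : Commute s p := by
    have hcl : IsClosed {x : A | s * x = x * s} :=
      isClosed_eq (continuous_const_mul s) (continuous_mul_const s)
    refine closure_minimal ?_ hcl (hp 0)
    rintro _ ⟨k, -, rfl⟩
    exact (Commute.self_pow s k).eq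
  have hlow : ∀ k, (C ^ 2)⁻¹ • (star p * p) ≤ star (s ^ k) * s ^ k := fun k => by
    have hcl : IsClosed {x : A | star x * x ≤ C ^ 2 • (star (s ^ k) * s ^ k)} :=
      isClosed_le (by fun_prop) continuous_const
    have h1 : star p * p ≤ C ^ 2 • (star (s ^ k) * s ^ k) := by
      refine closure_minimal ?_ hcl (hp k)
      rintro _ ⟨l, hl, rfl⟩
      obtain ⟨m, rfl⟩ := Nat.exists_eq_add_of_le' hl
      rw [Set.mem_ofPred_eq, pow_add]
      exact star_mul_self_mul_le (hC m) _
    have := smul_le_smul_of_nonneg_left h1 (inv_nonneg.2 (sq_nonneg C))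
    rwa [inv_smul_smul₀ (by positivity)] at this
  obtain ⟨q₁, hq₁, hq₁s⟩ := exists_invariant_cesaro_limit s hC hlow
  set r : A := 1 - p with hr
  have hrr : r * r = r := (IsIdempotentElem.one_sub hpp).eq
  have hsr : Commute s r := (Commute.one_right s).sub_right hcomm
  obtain ⟨m, hm, hmr⟩ : ∃ m, 1 ≤ m ∧ ‖s ^ m * r‖ ≤ 1 := by
    obtain ⟨_, ⟨m, hm, rfl⟩, hd⟩ := Metric.mem_closure_iff.1 (hp 1) (‖r‖ + 1)⁻¹ (by positivity)
    refine ⟨m, hm, ?_⟩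
    have hpr : p * r = 0 := by rw [hr, mul_sub, hpp, mul_one, sub_self]
    have : s ^ m * r = (s ^ m - p) * r := by rw [sub_mul, hpr, sub_zero]
    rw [this]
    rw [dist_comm, dist_eq_norm] at hd
    refine (norm_mul_le _ _).trans ?_
    calc _ ≤ (‖r‖ + 1)⁻¹ * (‖r‖ + 1) := by gcongr; linarith
      _ = 1 := inv_mul_cancel₀ (by positivity)
  set y : ℕ → A := fun k => star (s ^ k * r) * (s ^ k * r) with hy
  set q₂ : A := ∑ k ∈ Finset.range m, y k with hq₂
  have hys : ∀ k, star s * y k * s = y (k + 1) := fun k => by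
    have : s ^ (k + 1) * r = s ^ k * r * s := by rw [pow_succ, mul_assoc, hsr.eq, mul_assoc]
    simp only [hy, this]
    simp only [star_mul, mul_assoc]
  have hym : y m ≤ y 0 := by
    have := star_mul_self_mul_le hmr r
    rw [mul_assoc, hrr, one_pow, one_smul] at this
    simpa [hy] using this
  have hq₂s : star s * q₂ * s ≤ q₂ := by
    rw [← sub_nonpos, hq₂, Finset.mul_sum, Finset.sum_mul, ← Finset.sum_sub_distrib]
    simp only [hys, Finset.sum_range_sub]
    exact sub_nonpos.2 hym
  have hq₂r : star r * r ≤ q₂ := by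
    have := Finset.single_le_sum (f := y) (fun k _ => star_mul_self_nonneg _)
      (Finset.mem_range.2 (show 0 < m by omega))
    simpa only [hy, pow_zero, one_mul] using this
  refine ⟨q₁ + q₂, ?_, ?_⟩
  · set c : ℝ := min (C ^ 2)⁻¹ 1 with hc
    have hc0 : 0 < c := by positivity
    have hsum : (1 : A) ≤ (2 : ℝ) • (star p * p + star r * r) := by
      have h : (2 : ℝ) • (star p * p + star r * r) = 1 + star (p - r) * (p - r) := by
        simp only [hr, star_sub, star_one, two_smul]; noncomm_ring
      rw [h]
      exact le_add_of_nonneg_right (star_mul_self_nonneg _)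
    have hle : (c / 2) • (1 : A) ≤ q₁ + q₂ := by
      calc (c / 2) • (1 : A) ≤ (c / 2) • (2 : ℝ) • (star p * p + star r * r) :=
            smul_le_smul_of_nonneg_left hsum (by positivity)
        _ = c • (star p * p) + c • (star r * r) := by
            rw [smul_smul, div_mul_cancel₀ _ two_ne_zero, smul_add]
        _ ≤ (C ^ 2)⁻¹ • (star p * p) + (1 : ℝ) • (star r * r) :=
            add_le_add
              (smul_le_smul_of_nonneg_right (min_le_left _ _) (star_mul_self_nonneg _))
              (smul_le_smul_of_nonneg_right (min_le_right _ _) (star_mul_self_nonneg _))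
        _ ≤ q₁ + q₂ := by rw [one_smul]; exact add_le_add hq₁ hq₂r
    have hpos : IsStrictlyPositive ((c / 2) • (1 : A)) := by
      rw [IsStrictlyPositive.iff_of_unital]
      exact ⟨smul_nonneg (by positivity) zero_le_one,
        isUnit_one.smul (Units.mk0 (c / 2) (by positivity))⟩
    rw [IsStrictlyPositive.iff_of_unital]
    exact ⟨hpos.nonneg.trans hle, CStarAlgebra.isUnit_of_le _ hle hpos⟩
  · rw [mul_add, add_mul, hq₁s]
    exact add_le_add le_rfl hq₂s

/-- A power bounded element of a finite-dimensional C⋆-algebra is similar to a contraction. -/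
theorem exists_units_conjugate_contraction [ProperSpace A] (s : A) {C : ℝ}
    (hC : ∀ k, ‖s ^ k‖ ≤ C) :
    ∃ u : Aˣ, star (u * s * ↑u⁻¹ : A) * (u * s * ↑u⁻¹) ≤ 1 := by
  obtain ⟨q, hq, hqs⟩ := exists_isStrictlyPositive_conjugate_le s hC
  obtain ⟨u, hu⟩ := (CFC.isUnit_sqrt_iff q hq.nonneg).2 hq.isUnit
  have hself : star (u : A) = u := by
    rw [hu]; exact (CFC.sqrt_nonneg q).isSelfAdjoint
  have huu : (u : A) * u = q := by rw [hu]; exact CFC.sqrt_mul_sqrt_self q hq.nonneg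
  refine ⟨u, ?_⟩
  calc star (u * s * ↑u⁻¹ : A) * (u * s * ↑u⁻¹)
      = star (↑u⁻¹ : A) * (star s * (star (u : A) * u) * s) * ↑u⁻¹ := by
        simp only [star_mul, mul_assoc]
    _ ≤ star (↑u⁻¹ : A) * (star (u : A) * u) * ↑u⁻¹ := by
        rw [hself, huu]
        exact star_left_conjugate_le_conjugate hqs _
    _ = star (u * ↑u⁻¹ : A) * (u * ↑u⁻¹) := by simp only [star_mul, mul_assoc]
    _ = 1 := by simp

end CStar

/-- The delayed vectors of a bounded sequence with finite-dimensional span are produced by a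
linear system with a power bounded transition matrix. -/
theorem exists_powerBounded_realization (a : ℕ → ℝ) {C : ℝ} (hC : ∀ t, |a t| ≤ C)
    (v : ℕ → ℕ → ℝ) (hv : ∀ τ k, v τ k = a (τ + k))
    [FiniteDimensional ℝ (Submodule.span ℝ (Set.range v))] {n : ℕ}
    (hn : Module.finrank ℝ (Submodule.span ℝ (Set.range v)) = n) :
    ∃ (S : Matrix (Fin n) (Fin n) ℝ) (w x : Fin n → ℝ),
      (∀ i j, ∃ B, ∀ t, |(S ^ t) i j| ≤ B) ∧ ∀ t, a t = w ⬝ᵥ (S ^ t *ᵥ x) := by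
  set V := Submodule.span ℝ (Set.range v) with hV
  let L : (ℕ → ℝ) →ₗ[ℝ] (ℕ → ℝ) := LinearMap.funLeft ℝ ℝ Nat.succ
  have hLv : ∀ τ, L (v τ) = v (τ + 1) := fun τ => by
    ext k
    simp only [L, LinearMap.funLeft_apply, hv]
    congr 1; omega
  have hL : ∀ f ∈ V, L f ∈ V := by
    intro f hf
    induction hf using Submodule.span_induction with
    | mem f hf =>
      obtain ⟨τ, rfl⟩ := hf
      rw [hLv]
      exact Submodule.subset_span ⟨τ + 1, rfl⟩
    | zero => simp
    | add f g _ _ hf hg => rw [map_add]; exact V.add_mem hf hg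
    | smul c f _ hf => rw [map_smul]; exact V.smul_mem c hf
  have hbdd : ∀ f ∈ V, ∃ B, ∀ t, |f t| ≤ B := by
    intro f hf
    induction hf using Submodule.span_induction with
    | mem f hf =>
      obtain ⟨τ, rfl⟩ := hf
      exact ⟨C, fun t => by rw [hv]; exact hC _⟩
    | zero => exact ⟨0, fun t => by simp⟩
    | add f g _ _ hf hg =>
      obtain ⟨B, hB⟩ := hf
      obtain ⟨B', hB'⟩ := hg
      exact ⟨B + B', fun t => (abs_add_le _ _).trans (add_le_add (hB t) (hB' t))⟩
    | smul c f _ hf =>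
      obtain ⟨B, hB⟩ := hf
      refine ⟨|c| * B, fun t => ?_⟩
      rw [Pi.smul_apply, smul_eq_mul, abs_mul]
      exact mul_le_mul_of_nonneg_left (hB t) (abs_nonneg c)
  let T : V →ₗ[ℝ] V := L.restrict hL
  let ev : ℕ → Module.Dual ℝ V := fun k => (LinearMap.proj k).comp V.subtype
  have hT : ∀ t k (f : V), ev k ((T ^ t) f) = ev (t + k) f := by
    intro t
    induction t with
    | zero => simp
    | succ t ih =>
      intro k f
      rw [pow_succ', Module.End.mul_apply]
      have : ev k (T ((T ^ t) f)) = ev (k + 1) ((T ^ t) f) := rfl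
      rw [this, ih]
      congr 2; omega
  have horbit : ∀ (ψ : Module.Dual ℝ V) (f : V), ∃ B, ∀ t, |ψ ((T ^ t) f)| ≤ B := by
    intro ψ f
    have hψ : ψ ∈ Submodule.span ℝ (Set.range ev) := by
      refine FiniteDimensional.mem_span_of_iInf_ker_le_ker fun g hg => ?_
      have : g = 0 := by
        ext k
        exact (Submodule.mem_iInf _).1 hg k
      simp [this]
    induction hψ using Submodule.span_induction with
    | mem ψ hψ =>
      obtain ⟨k, rfl⟩ := hψ
      obtain ⟨B, hB⟩ := hbdd f f.2
      exact ⟨B, fun t => by rw [hT]; exact hB _⟩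
    | zero => exact ⟨0, fun t => by simp⟩
    | add f g _ _ hf hg =>
      obtain ⟨B, hB⟩ := hf
      obtain ⟨B', hB'⟩ := hg
      exact ⟨B + B', fun t => (abs_add_le _ _).trans (add_le_add (hB t) (hB' t))⟩
    | smul c f _ hf =>
      obtain ⟨B, hB⟩ := hf
      refine ⟨|c| * B, fun t => ?_⟩
      rw [LinearMap.smul_apply, smul_eq_mul, abs_mul]
      exact mul_le_mul_of_nonneg_left (hB t) (abs_nonneg c)
  let b := Module.finBasisOfFinrankEq ℝ V hn
  let v₀ : V := ⟨v 0, Submodule.subset_span ⟨0, rfl⟩⟩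
  refine ⟨LinearMap.toMatrix b b T, fun i => ev 0 (b i), b.repr v₀, fun i j => ?_, fun t => ?_⟩
  · obtain ⟨B, hB⟩ := horbit (b.coord i) (b j)
    refine ⟨B, fun t => ?_⟩
    rw [LinearMap.toMatrix_pow, LinearMap.toMatrix_apply]
    exact hB t
  · rw [LinearMap.toMatrix_pow, LinearMap.toMatrix_mulVec_repr]
    have h1 : a t = ev 0 ((T ^ t) v₀) := by
      rw [hT]
      simp [ev, v₀, hv]
    rw [h1]
    conv_lhs => rw [← b.sum_repr ((T ^ t) v₀), map_sum]
    simp [dotProduct, mul_comm]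

/-- A contraction `M` is implemented, on coherences with a reference state, by a channel. -/
theorem exists_channel_of_contraction {n : ℕ} (M : Matrix (Fin n) (Fin n) ℂ)
    (R : Matrix (Fin n) (Fin n) ℂ) (hR : 1 - Mᴴ * M = Rᴴ * R) (w x : Matrix (Fin n) Unit ℂ)
    (a : ℕ → ℝ)
    (ha : ∀ t, ((a t : ℂ)) = (wᴴ * (M ^ t * x)).trace) :
    ∃ (ρ : Matrix (Fin (n + 2)) (Fin (n + 2)) ℂ)
      (T : Module.End ℂ (Matrix (Fin (n + 2)) (Fin (n + 2)) ℂ))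
      (A : Matrix (Fin (n + 2)) (Fin (n + 2)) ℂ) (κ : ℕ)
      (K : Fin κ → Matrix (Fin (n + 2)) (Fin (n + 2)) ℂ),
      ρ.PosSemidef ∧ ρ.trace = 1 ∧ (∑ k, (K k)ᴴ * K k) = 1 ∧
      (∀ X, T X = ∑ k, K k * X * (K k)ᴴ) ∧ A.IsHermitian ∧
      ∀ t : ℕ, (a t : ℂ) = (A * ((T ^ t) ρ)).trace := by
  let J : Matrix (Fin (n + 2)) (Fin n) ℂ :=
    (1 : Matrix (Fin (n + 2)) (Fin (n + 2)) ℂ).submatrix id (fun j => j.succ.succ)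
  let e : Matrix (Fin (n + 2)) Unit ℂ :=
    (1 : Matrix (Fin (n + 2)) (Fin (n + 2)) ℂ).submatrix id (fun _ => 0)
  have hJJ : Jᴴ * J = 1 := by
    ext i j
    simp [J, Matrix.mul_apply, Matrix.one_apply]
  have hJe : Jᴴ * e = 0 := by
    ext i j
    simp [J, e, Matrix.mul_apply, Matrix.one_apply]
  have hee : eᴴ * e = 1 := by
    ext i j
    simp [e, Matrix.mul_apply, Matrix.one_apply]
  have heJ : eᴴ * J = 0 := by
    simpa using congrArg conjTranspose hJe
  clear_value J e
  let row : Fin n → Matrix Unit (Fin n) ℂ := fun j => R.submatrix (fun _ => j) id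
  have hrow : ∑ j, (row j)ᴴ * row j = 1 - Mᴴ * M := by
    rw [hR]
    ext i j
    simp [row, Matrix.mul_apply, Matrix.sum_apply]
  clear_value row
  let K₀ : Matrix (Fin (n + 2)) (Fin (n + 2)) ℂ := 1 - J * Jᴴ + J * M * Jᴴ
  let K : Fin (n + 1) → Matrix (Fin (n + 2)) (Fin (n + 2)) ℂ :=
    Fin.cons K₀ fun j => e * row j * Jᴴ
  have hJK₀ : Jᴴ * K₀ = M * Jᴴ := by
    simp only [K₀, Matrix.mul_add, Matrix.mul_sub, Matrix.mul_one, ← Matrix.mul_assoc, hJJ,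
      Matrix.one_mul, sub_self, zero_add]
  have heK₀ : eᴴ * K₀ = eᴴ := by
    simp only [K₀, Matrix.mul_add, Matrix.mul_sub, Matrix.mul_one, ← Matrix.mul_assoc, heJ,
      Matrix.zero_mul, sub_zero, add_zero]
  have hK₀e : K₀ᴴ * e = e := by simpa using congrArg conjTranspose heK₀
  have hK₀J : K₀ᴴ * J = J * Mᴴ := by simpa using congrArg conjTranspose hJK₀
  have hTP : ∑ k, (K k)ᴴ * K k = 1 := by
    have h0 : K₀ᴴ * K₀ = 1 - J * Jᴴ + J * (Mᴴ * M) * Jᴴ := by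
      have hd : K₀ᴴ * K₀ = K₀ᴴ - K₀ᴴ * J * Jᴴ + K₀ᴴ * J * M * Jᴴ := by
        conv_lhs => rw [show K₀ = 1 - J * Jᴴ + J * M * Jᴴ from rfl]
        simp only [Matrix.mul_add, Matrix.mul_sub, Matrix.mul_one, ← Matrix.mul_assoc]
        rfl
      rw [hd, hK₀J]
      simp only [K₀, conjTranspose_add, conjTranspose_sub, conjTranspose_one, conjTranspose_mul,
        conjTranspose_conjTranspose, Matrix.mul_assoc]
      abel
    have hj : ∀ j, (e * row j * Jᴴ)ᴴ * (e * row j * Jᴴ) = J * ((row j)ᴴ * row j) * Jᴴ := fun j => by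
      calc _ = J * ((row j)ᴴ * (eᴴ * e) * row j) * Jᴴ := by
            simp only [conjTranspose_mul, conjTranspose_conjTranspose, Matrix.mul_assoc]
        _ = _ := by rw [hee, Matrix.mul_one]
    rw [Fin.sum_univ_succ]
    simp only [K, Fin.cons_zero, Fin.cons_succ, h0, hj]
    rw [← Matrix.sum_mul, ← Matrix.mul_sum, hrow, Matrix.mul_sub, Matrix.sub_mul, Matrix.mul_one]
    abel
  let T : Module.End ℂ (Matrix (Fin (n + 2)) (Fin (n + 2)) ℂ) :=
    ∑ k, LinearMap.mulLeftRight ℂ (K k, (K k)ᴴ)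
  have hT : ∀ X, T X = ∑ k, K k * X * (K k)ᴴ := fun X => by
    simp [T, LinearMap.sum_apply]
  have hJT : ∀ X, Jᴴ * T X * e = M * (Jᴴ * X * e) := fun X => by
    have hj : ∀ j, Jᴴ * (e * row j * Jᴴ * X * (e * row j * Jᴴ)ᴴ) * e = 0 := fun j => by
      simp only [← Matrix.mul_assoc, hJe, Matrix.zero_mul]
    rw [hT, Fin.sum_univ_succ, Matrix.mul_add, Matrix.add_mul, Matrix.mul_sum, Matrix.sum_mul]
    simp only [K, Fin.cons_zero, Fin.cons_succ, hj, Finset.sum_const_zero, add_zero]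
    calc _ = (Jᴴ * K₀) * X * (K₀ᴴ * e) := by simp only [Matrix.mul_assoc]
      _ = _ := by rw [hJK₀, hK₀e]; simp only [Matrix.mul_assoc]
  have heT : ∀ X, eᴴ * T X * J = eᴴ * X * J * Mᴴ := fun X => by
    have hj : ∀ j, eᴴ * (e * row j * Jᴴ * X * (e * row j * Jᴴ)ᴴ) * J = 0 := fun j => by
      simp only [conjTranspose_mul, Matrix.mul_assoc, heJ, Matrix.mul_zero]
    rw [hT, Fin.sum_univ_succ, Matrix.mul_add, Matrix.add_mul, Matrix.mul_sum, Matrix.sum_mul]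
    simp only [K, Fin.cons_zero, Fin.cons_succ, hj, Finset.sum_const_zero, add_zero]
    calc _ = (eᴴ * K₀) * X * (K₀ᴴ * J) := by simp only [Matrix.mul_assoc]
      _ = _ := by rw [heK₀, hK₀J]; simp only [Matrix.mul_assoc]
  have hJTt : ∀ t X, Jᴴ * (T ^ t) X * e = M ^ t * (Jᴴ * X * e) := fun t X => by
    induction t with
    | zero => simp
    | succ t ih => rw [pow_succ', Module.End.mul_apply, hJT, ih, pow_succ', ← Matrix.mul_assoc]
  have heTt : ∀ t X, eᴴ * (T ^ t) X * J = eᴴ * X * J * (M ^ t)ᴴ := fun t X => by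
    induction t with
    | zero => simp
    | succ t ih =>
      rw [pow_succ', Module.End.mul_apply, heT, ih, pow_succ', conjTranspose_mul, Matrix.mul_assoc]
  let ψ : Matrix (Fin (n + 2)) Unit ℂ := e + J * x
  let r : ℝ := 1 + ∑ i, ‖x i ()‖ ^ 2
  have hr : 0 < r := by positivity
  have hJψ : Jᴴ * ψ = x := by
    simp only [ψ, Matrix.mul_add, hJe, ← Matrix.mul_assoc, hJJ, Matrix.one_mul, zero_add]
  have heψ : eᴴ * ψ = 1 := by
    simp only [ψ, Matrix.mul_add, hee, ← Matrix.mul_assoc, heJ, Matrix.zero_mul, add_zero]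
  have hψJ : ψᴴ * J = xᴴ := by simpa using congrArg conjTranspose hJψ
  have hψe : ψᴴ * e = 1 := by simpa using congrArg conjTranspose heψ
  have hψψ : (ψᴴ * ψ).trace = (r : ℂ) := by
    have : ψᴴ * ψ = 1 + xᴴ * x := by
      conv_lhs => rw [show ψ = e + J * x from rfl]
      rw [Matrix.mul_add, ← Matrix.mul_assoc]
      rw [show (e + J * x)ᴴ = ψᴴ from rfl, hψe, hψJ]
    rw [this]
    simp [Matrix.trace, Matrix.mul_apply, r, ← Complex.conj_mul']
  have hrC : (r : ℂ) ≠ 0 := by exact_mod_cast hr.ne'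
  have hJρ : Jᴴ * ((r⁻¹ : ℂ) • (ψ * ψᴴ)) * e = (r⁻¹ : ℂ) • x := by
    rw [Matrix.mul_smul, Matrix.smul_mul, ← Matrix.mul_assoc, hJψ, Matrix.mul_assoc, hψe,
      Matrix.mul_one]
  have heρ : eᴴ * ((r⁻¹ : ℂ) • (ψ * ψᴴ)) * J = (r⁻¹ : ℂ) • xᴴ := by
    rw [Matrix.mul_smul, Matrix.smul_mul, ← Matrix.mul_assoc, heψ, Matrix.mul_assoc, hψJ,
      Matrix.one_mul]
  refine ⟨(r⁻¹ : ℂ) • (ψ * ψᴴ), T, ((r / 2 : ℝ) : ℂ) • (e * wᴴ * Jᴴ + J * w * eᴴ), n + 1, K,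
    ?_, ?_, hTP, hT, ?_, fun t => ?_⟩
  · refine (Matrix.posSemidef_self_mul_conjTranspose ψ).smul ?_
    rw [← Complex.ofReal_inv]
    exact_mod_cast (inv_pos.2 hr).le
  · rw [Matrix.trace_smul, Matrix.trace_mul_comm, hψψ, smul_eq_mul, inv_mul_cancel₀ hrC]
  · simp only [Matrix.IsHermitian, conjTranspose_smul, conjTranspose_add, conjTranspose_mul,
      conjTranspose_conjTranspose, Matrix.mul_assoc]
    rw [add_comm (J * _)]
    simp
  · set Y := (T ^ t) ((r⁻¹ : ℂ) • (ψ * ψᴴ)) with hY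
    have h1 : (e * wᴴ * Jᴴ * Y).trace = (r⁻¹ : ℂ) * a t := by
      calc _ = (e * (wᴴ * Jᴴ * Y)).trace := by simp only [Matrix.mul_assoc]
        _ = (wᴴ * (Jᴴ * Y * e)).trace := by
          rw [Matrix.trace_mul_comm]; simp only [Matrix.mul_assoc]
        _ = _ := by
          rw [hY, hJTt, hJρ, Matrix.mul_smul, Matrix.mul_smul, Matrix.trace_smul, ← ha, smul_eq_mul]
    have h2 : (J * w * eᴴ * Y).trace = (r⁻¹ : ℂ) * a t := by
      calc _ = (J * (w * eᴴ * Y)).trace := by simp only [Matrix.mul_assoc]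
        _ = (w * (eᴴ * Y * J)).trace := by
          rw [Matrix.trace_mul_comm]; simp only [Matrix.mul_assoc]
        _ = (eᴴ * Y * J * w).trace := Matrix.trace_mul_comm _ _
        _ = (r⁻¹ : ℂ) * ((wᴴ * (M ^ t * x))ᴴ).trace := by
          rw [hY, heTt, heρ, Matrix.smul_mul, Matrix.smul_mul, Matrix.trace_smul, smul_eq_mul]
          simp only [conjTranspose_mul, conjTranspose_conjTranspose]
        _ = _ := by rw [Matrix.trace_conjTranspose, ← ha]; simp
    rw [Matrix.smul_mul, Matrix.trace_smul, Matrix.add_mul, Matrix.trace_add, h1, h2, smul_eq_mul]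
    push_cast
    field_simp
    ring

open scoped MatrixOrder Matrix.Norms.L2Operator in
/-- A power bounded real linear system can be realized by a complex contraction `M`, with
`R` a square root of `1 - Mᴴ * M`. -/
theorem exists_contraction_realization {n : ℕ} (S : Matrix (Fin n) (Fin n) ℝ) (w x : Fin n → ℝ)
    (hS : ∀ i j, ∃ B, ∀ t, |(S ^ t) i j| ≤ B) :
    ∃ (M R : Matrix (Fin n) (Fin n) ℂ) (w' x' : Matrix (Fin n) Unit ℂ),
      1 - Mᴴ * M = Rᴴ * R ∧
      ∀ t, ((w ⬝ᵥ (S ^ t *ᵥ x) : ℝ) : ℂ) = (w'ᴴ * (M ^ t * x')).trace := by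
  choose B hB using hS
  let s : Matrix (Fin n) (Fin n) ℂ := S.map (algebraMap ℝ ℂ)
  have hs : ∀ t, s ^ t = (S ^ t).map (algebraMap ℝ ℂ) := fun t => (Matrix.map_pow S _ t).symm
  have hsB : ∀ t, ‖s ^ t‖ ≤ ∑ i, ∑ j, B i j * ‖Matrix.single i j (1 : ℂ)‖ := fun t => by
    rw [Matrix.matrix_eq_sum_single (s ^ t)]
    refine norm_sum_le_of_le _ fun i _ => norm_sum_le_of_le _ fun j _ => ?_
    have : Matrix.single i j ((s ^ t) i j) = (s ^ t) i j • Matrix.single i j (1 : ℂ) := by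
      rw [Matrix.smul_single, smul_eq_mul, mul_one]
    rw [this, norm_smul]
    gcongr
    rw [hs]
    simpa using hB i j t
  have : ProperSpace (Matrix (Fin n) (Fin n) ℂ) := FiniteDimensional.proper ℂ _
  obtain ⟨u, hu⟩ := exists_units_conjugate_contraction s hsB
  obtain ⟨R, hR⟩ := CStarAlgebra.nonneg_iff_eq_star_mul_self.1 (sub_nonneg.2 hu)
  refine ⟨_, R, ((replicateRow Unit fun i => (w i : ℂ)) * (↑u⁻¹ : Matrix (Fin n) (Fin n) ℂ))ᴴ,
    (u : Matrix (Fin n) (Fin n) ℂ) * replicateCol Unit fun i => (x i : ℂ), hR, fun t => ?_⟩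
  rw [Units.conj_pow, conjTranspose_conjTranspose]
  have hinv : (↑u⁻¹ : Matrix (Fin n) (Fin n) ℂ) * u = 1 := u.inv_mul
  have : (replicateRow Unit fun i => (w i : ℂ)) * (↑u⁻¹ : Matrix (Fin n) (Fin n) ℂ) *
      ((u : Matrix (Fin n) (Fin n) ℂ) * s ^ t * (↑u⁻¹ : Matrix (Fin n) (Fin n) ℂ) *
        ((u : Matrix (Fin n) (Fin n) ℂ) * replicateCol Unit fun i => (x i : ℂ))) =
      (replicateRow Unit fun i => (w i : ℂ)) * (s ^ t * replicateCol Unit fun i => (x i : ℂ)) := by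
    calc _ = (replicateRow Unit fun i => (w i : ℂ)) * ((↑u⁻¹ * u : Matrix (Fin n) (Fin n) ℂ) *
          (s ^ t * ((↑u⁻¹ * u : Matrix (Fin n) (Fin n) ℂ) *
            replicateCol Unit fun i => (x i : ℂ)))) := by simp only [Matrix.mul_assoc]
      _ = _ := by rw [hinv, Matrix.one_mul, Matrix.one_mul]
  rw [this, hs]
  simp [Matrix.trace, Matrix.mul_apply, dotProduct, mulVec]

/-- quantum representation: every bounded real sequence whose space of
delayed vectors has finite dimension `D` arises as `a t = tr(A Tᵗ(ρ))` for a density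
matrix `ρ`, a completely positive trace-preserving map `T` (given in Kraus form), and a
Hermitian observable `A`, all on a Hilbert space of dimension `D + 2`. -/
theorem exists_quantum_representation (a : ℕ → ℝ)
    (hbdd : ∃ C : ℝ, ∀ t : ℕ, |a t| ≤ C)
    (v : ℕ → ℕ → ℝ) (hv : ∀ τ k : ℕ, v τ k = a (τ + k))
    (hfin : FiniteDimensional ℝ ↥(Submodule.span ℝ (Set.range v))) :
    ∃ (ρ : Matrix (Fin (Module.finrank ℝ ↥(Submodule.span ℝ (Set.range v)) + 2))
              (Fin (Module.finrank ℝ ↥(Submodule.span ℝ (Set.range v)) + 2)) ℂ)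
      (T : Module.End ℂ (Matrix (Fin (Module.finrank ℝ ↥(Submodule.span ℝ (Set.range v)) + 2))
              (Fin (Module.finrank ℝ ↥(Submodule.span ℝ (Set.range v)) + 2)) ℂ))
      (A : Matrix (Fin (Module.finrank ℝ ↥(Submodule.span ℝ (Set.range v)) + 2))
              (Fin (Module.finrank ℝ ↥(Submodule.span ℝ (Set.range v)) + 2)) ℂ)
      (κ : ℕ)
      (K : Fin κ → Matrix (Fin (Module.finrank ℝ ↥(Submodule.span ℝ (Set.range v)) + 2))
              (Fin (Module.finrank ℝ ↥(Submodule.span ℝ (Set.range v)) + 2)) ℂ),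
      ρ.PosSemidef ∧ ρ.trace = 1 ∧
      (∑ k, (K k)ᴴ * K k) = 1 ∧
      (∀ X, T X = ∑ k, K k * X * (K k)ᴴ) ∧
      A.IsHermitian ∧
      ∀ t : ℕ, (a t : ℂ) = (A * ((T ^ t) ρ)).trace := by
  obtain ⟨C, hC⟩ := hbdd
  obtain ⟨S, w, x, hS, ha⟩ := exists_powerBounded_realization a hC v hv rfl
  obtain ⟨M, R, w', x', hR, hM⟩ := exists_contraction_realization S w x hS
  exact exists_channel_of_contraction M R hR w' x' a fun t => by rw [ha, hM]
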